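/- Let X be a metric space that is locally compact and locally contractible. If X has the disjoint homotopies property (DHP), then X × ℝ has the disjoint disks property (DDP). -/

import Mathlib

open unitInterval

/-- `X` has the disjoint homotopies property: every pair of path homotopies
`f, g : D × I → X` (with `D = I = [0,1]`) can be approximated arbitrarily closely
by homotopies whose corresponding levels are disjoint. -/
def DisjointHomotopiesProperty (X : Type*) [MetricSpace X] : Prop :=
  ∀ (f g : C(I × I, X)) (ε : ℝ), 0 < ε →
    ∃ f' g' : C(I × I, X),
      (∀ p, dist (f p) (f' p) < ε) ∧ (∀ p, dist (g p) (g' p) < ε) ∧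
      ∀ t s s' : I, f' (s, t) ≠ g' (s', t)

/-- The closed unit 2-disk. -/
def D2 : Set (EuclideanSpace ℝ (Fin 2)) := Metric.closedBall 0 1

/-- `Z` has the disjoint disks property: any two maps of the 2-disk into `Z` can be
approximated arbitrarily closely by maps with disjoint images. -/
def DisjointDisksProperty (Z : Type*) [MetricSpace Z] : Prop :=
  ∀ (f g : C(D2, Z)) (ε : ℝ), 0 < ε →
    ∃ f' g' : C(D2, Z),
      (∀ p, dist (f p) (f' p) < ε) ∧ (∀ p, dist (g p) (g' p) < ε) ∧
      Set.range f' ∩ Set.range g' = ∅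

/-- `X` is locally contractible: each neighborhood of a point contains a smaller
neighborhood whose inclusion is null-homotopic. -/
def LocallyContractible (X : Type*) [TopologicalSpace X] : Prop :=
  ∀ x : X, ∀ U ∈ nhds x, ∃ V ∈ nhds x, ∃ hVU : V ⊆ U,
    ∃ u : U, ContinuousMap.Homotopic
      ⟨Set.inclusion hVU, continuous_inclusion hVU⟩ (ContinuousMap.const _ u)

section Gluing

variable {Z W : Type*} [TopologicalSpace Z] [TopologicalSpace W]

/-- A function defined by integer cells of a real coordinate is continuous as soon as it is
continuous on each closed cell and neighbouring formulas agree on the common face. -/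
lemma continuous_glue_floor {y : Z → ℝ} (hy : Continuous y) (F : ℤ → Z → W)
    (hF : ∀ k : ℤ, ContinuousOn (F k) {z | y z ∈ Set.Icc (k : ℝ) (k + 1)})
    (hag : ∀ (k : ℤ) (z : Z), y z = k + 1 → F k z = F (k + 1) z) :
    Continuous fun z => F ⌊y z⌋ z := by
  have hlf : LocallyFinite fun k : ℤ => Set.Icc (k : ℝ) (k + 1) := by
    intro a
    refine ⟨Set.Ioo (a - 1) (a + 1), Ioo_mem_nhds (by linarith) (by linarith), ?_⟩
    refine (Set.finite_Icc (⌊a⌋ - 2) (⌊a⌋ + 2)).subset ?_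
    rintro k ⟨b, ⟨hb1, hb2⟩, hb3, hb4⟩
    have h1 := Int.floor_le a
    have h2 := Int.lt_floor_add_one a
    constructor
    · have : ((⌊a⌋ - 2 : ℤ) : ℝ) < k + 1 := by push_cast; linarith
      have : ⌊a⌋ - 2 < k + 1 := by exact_mod_cast this
      omega
    · have : (k : ℝ) < ((⌊a⌋ + 2 : ℤ) : ℝ) := by push_cast; linarith
      have : k < ⌊a⌋ + 2 := by exact_mod_cast this
      omega
  refine (hlf.preimage_continuous hy).continuous ?_ (fun k => isClosed_Icc.preimage hy) ?_
  · refine Set.eq_univ_of_forall fun z => Set.mem_iUnion.2 ⟨⌊y z⌋, ?_⟩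
    exact ⟨Int.floor_le _, (Int.lt_floor_add_one _).le⟩
  · intro k
    refine (hF k).congr ?_
    rintro z ⟨h1, h2⟩
    beta_reduce
    rcases h2.lt_or_eq with h | h
    · rw [show ⌊y z⌋ = k from Int.floor_eq_iff.2 ⟨h1, h⟩]
    · rw [show ⌊y z⌋ = k + 1 from Int.floor_eq_iff.2 (by push_cast; constructor <;> linarith)]
      exact (hag k z h).symm

end Gluing

section Contraction

variable {X : Type*} [MetricSpace X]

/-- `c` contracts the ball `B(x, ρ)` to `u` inside the ball `B(x, r)`; the contraction is
stationary for times outside `[0, 1]`. -/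
structure BallContraction (x : X) (ρ r : ℝ) (c : X → ℝ → X) (u : X) : Prop where
  continuousOn : ContinuousOn (fun p : X × ℝ => c p.1 p.2) (Metric.ball x ρ ×ˢ Set.univ)
  at_zero : ∀ z ∈ Metric.ball x ρ, c z 0 = z
  of_one_le : ∀ z ∈ Metric.ball x ρ, ∀ t, 1 ≤ t → c z t = u
  mem_ball : ∀ z ∈ Metric.ball x ρ, ∀ t, c z t ∈ Metric.ball x r

lemma LocallyContractible.exists_ballContraction (h : LocallyContractible X) (x : X) {r : ℝ}
    (hr : 0 < r) : ∃ ρ > 0, ∃ c u, BallContraction x ρ r c u := by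
  obtain ⟨V, hV, hVU, u, ⟨H⟩⟩ := h x _ (Metric.ball_mem_nhds x hr)
  obtain ⟨ρ, hρ, hρV⟩ := Metric.mem_nhds_iff.1 hV
  classical
  refine ⟨ρ, hρ, fun z t => if hz : z ∈ V then
    (H (Set.projIcc 0 1 zero_le_one t, ⟨z, hz⟩) : X) else z, u, ?_, ?_, ?_, ?_⟩
  · rw [continuousOn_iff_continuous_domRestrict]
    have : Continuous fun p : (Metric.ball x ρ ×ˢ Set.univ : Set (X × ℝ)) =>
        (H (Set.projIcc 0 1 zero_le_one p.1.2, ⟨p.1.1, hρV p.2.1⟩) : X) := by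
      refine continuous_subtype_val.comp (H.continuous.comp ?_)
      refine Continuous.prodMk (continuous_projIcc.comp (by fun_prop)) ?_
      exact Continuous.subtype_mk (by fun_prop) _
    refine this.congr fun p => ?_
    simp [hρV p.2.1]
  · intro z hz
    simp [hρV hz]
  · intro z hz t ht
    simp only [hρV hz, dite_true, Set.projIcc_of_right_le zero_le_one ht]
    exact congrArg Subtype.val (H.apply_one _)
  · intro z hz t
    simp only [hρV hz, dite_true]
    exact Subtype.property _

lemma BallContraction.mono {x x' : X} {ρ ρ' r r' : ℝ} {c : X → ℝ → X} {u : X}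
    (h : BallContraction x ρ r c u) (hρ : Metric.ball x' ρ' ⊆ Metric.ball x ρ)
    (hr : Metric.ball x r ⊆ Metric.ball x' r') : BallContraction x' ρ' r' c u where
  continuousOn := h.continuousOn.mono (Set.prod_mono hρ subset_rfl)
  at_zero z hz := h.at_zero z (hρ hz)
  of_one_le z hz := h.of_one_le z (hρ hz)
  mem_ball z hz t := hr (h.mem_ball z (hρ hz) t)

lemma LocallyContractible.exists_uniform_ballContraction (h : LocallyContractible X) {K : Set X}
    (hK : IsCompact K) {r : ℝ} (hr : 0 < r) :
    ∃ ρ > 0, ∀ x ∈ K, ∃ c u, BallContraction x ρ r c u := by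
  choose ρ hρ c u hc using fun x : X => h.exists_ballContraction x (half_pos hr)
  obtain ⟨δ, hδ, hδK⟩ := lebesgue_number_lemma_of_metric (c := fun x => Metric.ball x
    (min (ρ x) (r / 2))) hK (fun _ => Metric.isOpen_ball) (fun x _ => Set.mem_iUnion.2
      ⟨x, Metric.mem_ball_self (lt_min (hρ x) (half_pos hr))⟩)
  refine ⟨δ, hδ, fun x hx => ?_⟩
  obtain ⟨i, hi⟩ := hδK x hx
  refine ⟨c i, u i, (hc i).mono (hi.trans (Metric.ball_subset_ball (min_le_left _ _))) ?_⟩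
  refine Metric.ball_subset_ball' ?_
  have := Metric.mem_ball'.1 (hi (Metric.mem_ball_self hδ))
  have := this.trans_le (min_le_right _ _)
  linarith

/-- Cellwise application of contractions, with time parameter vanishing on the cell faces. -/
lemma continuous_cellwise_contraction {Z : Type*} [TopologicalSpace Z] {x : ℤ → X} {ρ r : ℝ}
    {c : ℤ → X → ℝ → X} {u : ℤ → X} (hc : ∀ k, BallContraction (x k) ρ r (c k) (u k))
    {γ : Z → X} (hγ : Continuous γ) {y a : Z → ℝ} (hy : Continuous y) (ha : Continuous a)
    (ha0 : ∀ (k : ℤ) z, y z = k → a z = 0)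
    (hmem : ∀ (k : ℤ) z, y z ∈ Set.Icc (k : ℝ) (k + 1) → γ z ∈ Metric.ball (x k) ρ) :
    Continuous fun z => c ⌊y z⌋ (γ z) (a z) := by
  refine continuous_glue_floor hy (fun k z => c k (γ z) (a z)) (fun k => ?_) fun k z hz => ?_
  · exact (hc k).continuousOn.comp (hγ.prodMk ha).continuousOn
      fun z hz => ⟨hmem k z hz, Set.mem_univ _⟩
  · have h0 : a z = 0 := ha0 (k + 1) z (by push_cast; exact hz)
    rw [h0, (hc k).at_zero _ (hmem k z ⟨by linarith, hz.le⟩),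
      (hc (k + 1)).at_zero _ (hmem (k + 1) z (by push_cast; constructor <;> linarith))]

end Contraction

section Extension

variable {X : Type*} [MetricSpace X]

/-- All paths close to `γ` can be deformed, near `γ`, to one and the same path. -/
lemma LocallyContractible.exists_common_deformation (h : LocallyContractible X) (γ : C(I, X))
    {ε : ℝ} (hε : 0 < ε) :
    ∃ δ > 0, ∃ θ : C(I, X), ∀ γ' : C(I, X), (∀ y, dist (γ' y) (γ y) < δ) →
      ContinuousMap.HomotopicWith γ' θ (fun η => ∀ y, dist (η y) (γ y) < ε) := by
  have hK : IsCompact (Set.range γ) := isCompact_range γ.continuous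
  obtain ⟨ρ₁, hρ₁, hd⟩ := h.exists_uniform_ballContraction hK (half_pos hε)
  obtain ⟨ρ₂, hρ₂, hc⟩ := h.exists_uniform_ballContraction hK (half_pos hρ₁)
  obtain ⟨μ, hμ, hμγ⟩ := Metric.uniformContinuous_iff.1
    (CompactSpace.uniformContinuous_of_continuous γ.continuous)
    (min (ρ₁ / 2) (min (ρ₂ / 2) (ε / 2))) (by positivity)
  obtain ⟨n, hn⟩ := exists_nat_gt (1 / μ)
  have hn0 : (0 : ℝ) < n := lt_trans (by positivity) hn
  have hnμ : 1 / (n : ℝ) < μ := by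
    rw [div_lt_iff₀ hn0]; rw [div_lt_iff₀ hμ] at hn; linarith
  set v : ℤ → I := fun k => Set.projIcc 0 1 zero_le_one ((k : ℝ) / n) with hv
  have hproj : ∀ (a b : ℝ), |a - b| ≤ 1 → dist (γ (Set.projIcc 0 1 zero_le_one (a / n)))
      (γ (Set.projIcc 0 1 zero_le_one (b / n))) < min (ρ₁ / 2) (min (ρ₂ / 2) (ε / 2)) := by
    intro a b hab
    refine hμγ (lt_of_le_of_lt ?_ hnμ)
    refine ((LipschitzWith.projIcc zero_le_one).dist_le_mul _ _).trans ?_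
    rw [NNReal.coe_one, one_mul, Real.dist_eq, ← sub_div, abs_div, abs_of_pos hn0]
    gcongr
  have hvy : ∀ (k : ℤ) (y : I), |(n : ℝ) * y - k| ≤ 1 →
      dist (γ y) (γ (v k)) < min (ρ₁ / 2) (min (ρ₂ / 2) (ε / 2)) := by
    intro k y hky
    have := hproj _ _ hky
    rwa [mul_div_cancel_left₀ _ hn0.ne', Set.projIcc_val] at this
  choose c u hcu using fun k : ℤ => hc (γ (v k)) (Set.mem_range_self _)
  choose d w hdw using fun k : ℤ => hd (γ (v k)) (Set.mem_range_self _)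
  -- `A` is at least `1` near the vertices `k / n`, and `B` is at least `1` away from them
  set A : I → ℝ := fun y => 1 + Real.cos (2 * Real.pi * (n * y)) with hA
  set B : I → ℝ := fun y => 1 - Real.cos (2 * Real.pi * (n * y)) with hB
  have hA0 : ∀ (k : ℤ) (y : I), (n : ℝ) * y + 1 / 2 = k → A y = 0 := by
    intro k y hky
    have : 2 * Real.pi * (n * y) = -Real.pi + k * (2 * Real.pi) := by
      rw [← hky]; ring
    simp [hA, this, Real.cos_add_int_mul_two_pi]
  have hB0 : ∀ (k : ℤ) (y : I), (n : ℝ) * y = k → B y = 0 := by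
    intro k y hky
    have : 2 * Real.pi * (n * y) = k * (2 * Real.pi) := by
      rw [← hky]; ring
    simp [hB, this, Real.cos_int_mul_two_pi]
  have hAcont : Continuous A := by fun_prop
  have hBcont : Continuous B := by fun_prop
  set j : I → ℤ := fun y => ⌊(n : ℝ) * y + 1 / 2⌋ with hj
  set k : I → ℤ := fun y => ⌊(n : ℝ) * y⌋ with hk
  have hjy : ∀ y, |(n : ℝ) * y - j y| ≤ 1 := by
    intro y
    have h1 := Int.floor_le ((n : ℝ) * y + 1 / 2)
    have h2 := Int.lt_floor_add_one ((n : ℝ) * y + 1 / 2)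
    rw [abs_le]; constructor <;> simp only [hj] <;> linarith
  have hbound : ∀ γ' : C(I, X), (∀ y, dist (γ' y) (γ y) < ρ₂ / 2) → ∀ (i : ℤ) (y : I),
      |(n : ℝ) * y - i| ≤ 1 → γ' y ∈ Metric.ball (γ (v i)) ρ₂ := by
    intro γ' hγ' i y hi
    have h1 := (hvy i y hi).trans_le ((min_le_right _ _).trans (min_le_left _ _))
    exact (dist_triangle _ (γ y) _).trans_lt (by linarith [hγ' y])
  have hmid : ∀ γ' : C(I, X), (∀ y, dist (γ' y) (γ y) < ρ₂ / 2) → ∀ (s : ℝ) (i : ℤ) (y : I),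
      (n : ℝ) * y ∈ Set.Icc (i : ℝ) (i + 1) →
        c (j y) (γ' y) (s * A y) ∈ Metric.ball (γ (v i)) ρ₁ := by
    intro γ' hγ' s i y hi
    have h1 := (hcu (j y)).mem_ball _ (hbound γ' hγ' _ y (hjy y)) (s * A y)
    have h2 : dist (γ (v (j y))) (γ (v i)) < ρ₁ / 2 := by
      refine (hproj _ _ ?_).trans_le (min_le_left _ _)
      have h3 := Int.floor_le ((n : ℝ) * y + 1 / 2)
      have h4 := Int.lt_floor_add_one ((n : ℝ) * y + 1 / 2)
      obtain ⟨h5, h6⟩ := hi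
      have h7 : (i : ℝ) < (j y + 1 : ℤ) := by push_cast; simp only [hj]; linarith
      have h8 : (j y : ℝ) < (i + 2 : ℤ) := by push_cast; simp only [hj]; linarith
      have h7 : i < j y + 1 := by exact_mod_cast h7
      have h8 : j y < i + 2 := by exact_mod_cast h8
      have h9 : |j y - i| ≤ 1 := by rw [abs_le]; constructor <;> omega
      exact_mod_cast h9
    exact (dist_triangle _ (γ (v (j y))) _).trans_lt (by linarith [Metric.mem_ball.1 h1])
  have hkI : ∀ y : I, (n : ℝ) * y ∈ Set.Icc ((k y : ℤ) : ℝ) (k y + 1) := fun y =>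
    ⟨Int.floor_le _, (Int.lt_floor_add_one _).le⟩
  set E : C(I, X) → I × I → X := fun γ' p =>
    d (k p.2) (c (j p.2) (γ' p.2) (p.1 * A p.2)) (p.1 * B p.2) with hE
  have hEcont : ∀ γ' : C(I, X), (∀ y, dist (γ' y) (γ y) < ρ₂ / 2) → Continuous (E γ') := by
    intro γ' hγ'
    have hinner : Continuous fun p : I × I => c (j p.2) (γ' p.2) (p.1 * A p.2) := by
      refine continuous_cellwise_contraction hcu (γ := fun p : I × I => γ' p.2)
        (y := fun p : I × I => (n : ℝ) * p.2 + 1 / 2) (a := fun p => p.1 * A p.2)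
        (by fun_prop) (by fun_prop) (by fun_prop) ?_ ?_
      · intro i p hp
        simp [hA0 i p.2 hp]
      · rintro i p ⟨h1, h2⟩
        refine hbound γ' hγ' i p.2 ?_
        rw [abs_le]; constructor <;> linarith
    refine continuous_cellwise_contraction hdw (y := fun p : I × I => (n : ℝ) * p.2)
      (a := fun p => p.1 * B p.2) hinner (by fun_prop) (by fun_prop) ?_ ?_
    · intro i p hp
      simp [hB0 i p.2 hp]
    · exact fun i p hp => hmid γ' hγ' _ i p.2 hp
  have hE0 : ∀ γ' : C(I, X), (∀ y, dist (γ' y) (γ y) < ρ₂ / 2) → ∀ y, E γ' (0, y) = γ' y := by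
    intro γ' hγ' y
    have h1 := hmid γ' hγ' 0 (k y) y (hkI y)
    simp only [hE, Set.Icc.coe_zero, zero_mul] at h1 ⊢
    rw [(hdw _).at_zero _ h1, (hcu _).at_zero _ (hbound γ' hγ' _ y (hjy y))]
  have hγself : ∀ y, dist (γ y) (γ y) < ρ₂ / 2 := fun y => by simpa using half_pos hρ₂
  have hE1 : ∀ γ' : C(I, X), (∀ y, dist (γ' y) (γ y) < ρ₂ / 2) → ∀ y,
      E γ' (1, y) = E γ (1, y) := by
    intro γ' hγ' y
    simp only [hE, Set.Icc.coe_one, one_mul]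
    rcases le_total 0 (Real.cos (2 * Real.pi * (n * y))) with hcos | hcos
    · have hA1 : 1 ≤ A y := by simp only [hA]; linarith
      rw [(hcu _).of_one_le _ (hbound γ' hγ' _ y (hjy y)) _ hA1,
        (hcu _).of_one_le _ (hbound γ hγself _ y (hjy y)) _ hA1]
    · have hB1 : 1 ≤ B y := by simp only [hB]; linarith
      have h1 := hmid γ' hγ' 1 (k y) y (hkI y)
      have h2 := hmid γ hγself 1 (k y) y (hkI y)
      rw [one_mul] at h1 h2
      rw [(hdw _).of_one_le _ h1 _ hB1, (hdw _).of_one_le _ h2 _ hB1]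
  refine ⟨ρ₂ / 2, half_pos hρ₂, ⟨fun y => E γ (1, y), (hEcont γ hγself).comp (by fun_prop)⟩, ?_⟩
  intro γ' hγ'
  refine ⟨⟨⟨⟨E γ', hEcont γ' hγ'⟩, hE0 γ' hγ', hE1 γ' hγ'⟩, fun t y => ?_⟩⟩
  change dist (E γ' (t, y)) (γ y) < ε
  have h1 := (hdw (k y)).mem_ball _ (hmid γ' hγ' t (k y) y (hkI y)) (t * B y)
  have h2 : dist (γ y) (γ (v (k y))) < ε / 2 := by
    refine (hvy _ _ ?_).trans_le ((min_le_right _ _).trans (min_le_right _ _))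
    have := hkI y
    rw [abs_le]; constructor <;> linarith [this.1, this.2]
  rw [dist_comm] at h2
  exact (dist_triangle _ (γ (v (k y))) _).trans_lt (by linarith [Metric.mem_ball.1 h1])

/-- The path space of a locally contractible space is locally path connected. -/
lemma LocallyContractible.exists_small_homotopy (h : LocallyContractible X) (γ : C(I, X))
    {ε : ℝ} (hε : 0 < ε) :
    ∃ δ > 0, ∀ γ' : C(I, X), (∀ y, dist (γ' y) (γ y) < δ) →
      ContinuousMap.HomotopicWith γ' γ (fun η => ∀ y, dist (η y) (γ y) < ε) := by
  obtain ⟨δ, hδ, θ, hθ⟩ := h.exists_common_deformation γ hε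
  exact ⟨δ, hδ, fun γ' hγ' => (hθ γ' hγ').trans (hθ γ fun y => by simpa using hδ).symm⟩

lemma LocallyContractible.exists_extension_right (h : LocallyContractible X) (f : C(I × I, X))
    (b : I) {ε : ℝ} (hε : 0 < ε) :
    ∃ δ > 0, ∀ f₀ : C(I × I, X), (∀ y, dist (f₀ (b, y)) (f (b, y)) < δ) →
      ∃ f' : C(I × I, X), (∀ x ≤ b, ∀ y, f' (x, y) = f₀ (x, y)) ∧
        ∀ x, b ≤ x → ∀ y, dist (f' (x, y)) (f (x, y)) < ε := by
  obtain ⟨δ, hδ, hδf⟩ := h.exists_small_homotopy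
    (f.comp ⟨fun y : I => (b, y), by fun_prop⟩) (half_pos hε)
  obtain ⟨μ, hμ, hμf⟩ := Metric.uniformContinuous_iff.1
    (CompactSpace.uniformContinuous_of_continuous f.continuous) (ε / 2) (half_pos hε)
  refine ⟨δ, hδ, fun f₀ hf₀ => ?_⟩
  obtain ⟨H⟩ := hδf (f₀.comp ⟨fun y : I => (b, y), by fun_prop⟩) hf₀
  have hH0 : ∀ y, H.toHomotopy (0, y) = f₀ (b, y) := fun y => H.toHomotopy.apply_zero y
  have hH1 : ∀ y, H.toHomotopy (1, y) = f (b, y) := fun y => H.toHomotopy.apply_one y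
  have hHε : ∀ s y, dist (H.toHomotopy (s, y)) (f (b, y)) < ε / 2 := fun s y => H.prop' s y
  set η := μ / 2 with hη
  have hη0 : 0 < η := half_pos hμ
  classical
  set g : I × I → X := fun p => if (p.1 : ℝ) ≤ b then f₀ p else
    if (p.1 : ℝ) ≤ b + η then
      H.toHomotopy (Set.projIcc 0 1 zero_le_one ((p.1 - b : ℝ) / η), p.2)
    else f (Set.projIcc 0 1 zero_le_one (p.1 - η : ℝ), p.2) with hg
  have hgc : Continuous g := by
    refine Continuous.if_le f₀.continuous (Continuous.if_le ?_ ?_ (by fun_prop) (by fun_prop) ?_)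
      (by fun_prop) (by fun_prop) ?_
    · refine H.toHomotopy.continuous.comp (Continuous.prodMk (continuous_projIcc.comp ?_)
        continuous_snd)
      fun_prop
    · refine f.continuous.comp (Continuous.prodMk (continuous_projIcc.comp ?_) continuous_snd)
      fun_prop
    · rintro ⟨x, y⟩ hx
      have h1 : (x - b : ℝ) / η = 1 := by simp only at hx; rw [hx]; field_simp; ring
      have h2 : (x - η : ℝ) = b := by simp only at hx; linarith
      simp only [h1, h2, Set.projIcc_right, Set.projIcc_val]
      exact hH1 y
    · rintro ⟨x, y⟩ hx
      obtain rfl : x = b := Subtype.ext hx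
      simp only [sub_self, zero_div, Set.projIcc_left]
      rw [if_pos (by linarith)]
      exact (hH0 y).symm
  refine ⟨⟨g, hgc⟩, fun x hx y => if_pos hx, fun x hx y => ?_⟩
  change dist (g (x, y)) (f (x, y)) < ε
  have hbx : (b : ℝ) ≤ x := hx
  have hmid : (x : ℝ) ≤ b + η → ∀ s, dist (H.toHomotopy (s, y)) (f (x, y)) < ε := by
    intro h1 s
    have h2 : dist (f (b, y)) (f (x, y)) < ε / 2 := by
      refine hμf ?_
      rw [Prod.dist_eq, dist_self, max_eq_left dist_nonneg, Subtype.dist_eq, Real.dist_eq, abs_lt]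
      constructor <;> linarith
    exact (dist_triangle _ (f (b, y)) _).trans_lt (by linarith [hHε s y])
  simp only [hg]
  split_ifs with h1 h2
  · obtain rfl : x = b := Subtype.ext (le_antisymm h1 hbx)
    rw [← hH0]
    exact hmid (by linarith) 0
  · exact hmid h2 _
  · refine (hμf ?_).trans (half_lt_self hε)
    rw [Prod.dist_eq, dist_self, max_eq_left dist_nonneg]
    have h3 := (LipschitzWith.projIcc (zero_le_one (α := ℝ))).dist_le_mul (x - η) x
    rw [Set.projIcc_val, NNReal.coe_one, one_mul] at h3
    refine h3.trans_lt ?_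
    rw [Real.dist_eq, abs_lt]
    constructor <;> linarith

lemma LocallyContractible.exists_extension_left (h : LocallyContractible X) (f : C(I × I, X))
    (a : I) {ε : ℝ} (hε : 0 < ε) :
    ∃ δ > 0, ∀ f₀ : C(I × I, X), (∀ y, dist (f₀ (a, y)) (f (a, y)) < δ) →
      ∃ f' : C(I × I, X), (∀ x, a ≤ x → ∀ y, f' (x, y) = f₀ (x, y)) ∧
        ∀ x ≤ a, ∀ y, dist (f' (x, y)) (f (x, y)) < ε := by
  let R : C(I × I, I × I) := ⟨fun p => (σ p.1, p.2), by fun_prop⟩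
  obtain ⟨δ, hδ, hf⟩ := h.exists_extension_right (f.comp R) (σ a) hε
  refine ⟨δ, hδ, fun f₀ hf₀ => ?_⟩
  obtain ⟨f', h1, h2⟩ := hf (f₀.comp R) fun y => by simpa [R] using hf₀ y
  refine ⟨f'.comp R, fun x hx y => ?_, fun x hx y => ?_⟩
  · simpa [R] using h1 (σ x) (unitInterval.symm_le_symm.2 hx) y
  · simpa [R] using h2 (σ x) (unitInterval.symm_le_symm.2 hx) y

/-- A small perturbation of `f` over a vertical strip of the square extends to a small
perturbation of `f` over the whole square. -/
lemma LocallyContractible.exists_extension_strip (h : LocallyContractible X) (f : C(I × I, X))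
    {a b : I} (hab : a ≤ b) {ε : ℝ} (hε : 0 < ε) :
    ∃ δ > 0, ∀ f₀ : C(I × I, X),
      (∀ x ∈ Set.Icc a b, ∀ y, dist (f₀ (x, y)) (f (x, y)) < δ) →
      ∃ f' : C(I × I, X), (∀ x ∈ Set.Icc a b, ∀ y, f' (x, y) = f₀ (x, y)) ∧
        ∀ p, dist (f' p) (f p) < ε := by
  obtain ⟨δ₁, hδ₁, hl⟩ := h.exists_extension_left f a hε
  obtain ⟨δ₂, hδ₂, hr⟩ := h.exists_extension_right f b hε
  refine ⟨min ε (min δ₁ δ₂), by positivity, fun f₀ hf₀ => ?_⟩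
  obtain ⟨f₁, h1, h1'⟩ := hr f₀ fun y => (hf₀ b ⟨hab, le_rfl⟩ y).trans_le
    ((min_le_right _ _).trans (min_le_right _ _))
  obtain ⟨f₂, h2, h2'⟩ := hl f₁ fun y => by
    rw [h1 a hab]
    exact (hf₀ a ⟨le_rfl, hab⟩ y).trans_le ((min_le_right _ _).trans (min_le_left _ _))
  refine ⟨f₂, fun x hx y => (h2 x hx.1 y).trans (h1 x hx.2 y), ?_⟩
  rintro ⟨x, y⟩
  rcases le_total x a with hxa | hxa
  · exact h2' x hxa y
  rw [h2 x hxa]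
  rcases le_total x b with hxb | hxb
  · rw [h1 x hxb]
    exact (hf₀ x ⟨hxa, hxb⟩ y).trans_le (min_le_left _ _)
  · exact h1' x hxb y

end Extension

section Levels

/-- A real function on the square can be approximated by one which, on each of finitely many
vertical strips covering the square, is a coordinate complementary to the second projection. -/
lemma exists_strip_coordinates (α : C(I × I, ℝ)) {ε : ℝ} (hε : 0 < ε) :
    ∃ α' : C(I × I, ℝ), (∀ p, dist (α p) (α' p) < ε) ∧
      ∃ (n : ℕ) (a b : Fin n → I), (∀ k, a k ≤ b k) ∧ (∀ x, ∃ k, x ∈ Set.Icc (a k) (b k)) ∧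
        ∀ k, ∃ r : C(I × ℝ, I × I), ∀ x ∈ Set.Icc (a k) (b k), ∀ y, r (y, α' (x, y)) = (x, y) := by
  set e := ε / 6 with he
  have he0 : 0 < e := by positivity
  obtain ⟨μ, hμ, hμα⟩ := Metric.uniformContinuous_iff.1
    (CompactSpace.uniformContinuous_of_continuous α.continuous) e he0
  obtain ⟨n, hn⟩ := exists_nat_gt (1 / μ)
  have hn0 : (0 : ℝ) < n := lt_trans (by positivity) hn
  have hnμ : 1 / (n : ℝ) < μ := by
    rw [div_lt_iff₀ hn0]; rw [div_lt_iff₀ hμ] at hn; linarith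
  set v : ℝ → I := fun x => Set.projIcc 0 1 zero_le_one (x / n) with hv
  have hvcont : Continuous v := continuous_projIcc.comp (by fun_prop)
  have hvα : ∀ x x' y, |x - x'| ≤ 1 → |α (v x, y) - α (v x', y)| < e := by
    intro x x' y hx
    refine hμα ?_
    rw [Prod.dist_eq, dist_self, max_eq_left dist_nonneg]
    refine lt_of_le_of_lt ?_ hnμ
    refine ((LipschitzWith.projIcc zero_le_one).dist_le_mul _ _).trans ?_
    rw [NNReal.coe_one, one_mul, Real.dist_eq, ← sub_div, abs_div, abs_of_pos hn0]
    gcongr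
  have hvx : ∀ x : I, v (n * x) = x := fun x => by
    simp only [hv]; rw [mul_div_cancel_left₀ _ hn0.ne', Set.projIcc_val]
  set l : ℤ → I → ℝ := fun k y => α (v k, y) + (-1) ^ k * e with hl
  have hlcont : ∀ k, Continuous (l k) := fun k => by fun_prop
  set Δ : ℤ → I → ℝ := fun k y => l (k + 1) y - l k y with hΔ
  have hsign : ∀ k : ℤ, ((-1 : ℝ)) ^ k = 1 ∨ ((-1 : ℝ)) ^ k = -1 := fun k => by
    rcases Int.even_or_odd k with h | h
    · exact Or.inl h.neg_one_zpow
    · exact Or.inr h.neg_one_zpow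
  have hΔk : ∀ k y, Δ k y ≠ 0 ∧ |Δ k y| ≤ 3 * e := by
    intro k y
    have h1 := abs_lt.1 (hvα (k + 1 : ℤ) k y (by simp))
    have h2 : Δ k y = (α (v (k + 1 : ℤ), y) - α (v k, y)) - 2 * ((-1) ^ k * e) := by
      simp only [hΔ, hl, zpow_add_one₀ (by norm_num : (-1 : ℝ) ≠ 0)]; ring
    rw [h2]
    rcases hsign k with h | h <;> rw [h] <;> refine ⟨fun h0 => ?_, abs_le.2 ⟨?_, ?_⟩⟩ <;> linarith
  set F : ℤ → I × I → ℝ := fun k p => l k p.2 + (n * p.1 - k) * Δ k p.2 with hF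
  have hglue : ∀ (k : ℤ) (p : I × I), (n : ℝ) * p.1 = k + 1 → F k p = F (k + 1) p := by
    intro k p hp
    simp only [hF, hp, hΔ]; push_cast; ring
  have hΔcont : ∀ k, Continuous (Δ k) := fun k => (hlcont _).sub (hlcont _)
  have hFcont : Continuous fun p : I × I => F ⌊(n : ℝ) * p.1⌋ p :=
    continuous_glue_floor (y := fun p : I × I => (n : ℝ) * p.1) (by fun_prop) F
      (fun k => Continuous.continuousOn (by
        have := hlcont k
        have := hΔcont k
        simp only [hF]
        fun_prop)) hglue
  refine ⟨⟨_, hFcont⟩, ?_, n + 1, fun k => v k, fun k => v (k + 1), fun k => ?_, fun x => ?_,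
    fun k => ?_⟩
  · rintro ⟨x, y⟩
    change dist _ (F ⌊(n : ℝ) * x⌋ (x, y)) < ε
    set k := ⌊(n : ℝ) * x⌋
    have h1 : (k : ℝ) ≤ n * x := Int.floor_le _
    have h2 : (n : ℝ) * x < k + 1 := Int.lt_floor_add_one _
    have h3 := hvα (n * x) k y (by rw [abs_le]; constructor <;> linarith)
    rw [hvx] at h3
    have h4 : |((n : ℝ) * x - k) * Δ k y| ≤ 3 * e := by
      rw [abs_mul]
      have : |(n : ℝ) * x - k| ≤ 1 := by rw [abs_le]; constructor <;> linarith
      nlinarith [(hΔk k y).2, abs_nonneg (Δ k y), abs_nonneg ((n : ℝ) * x - k)]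
    rw [abs_le] at h4
    rw [abs_lt] at h3
    rw [Real.dist_eq, abs_lt]
    simp only [hF, hl]
    rcases hsign k with h | h <;> rw [h] <;> constructor <;> linarith
  · exact Set.monotone_projIcc _ (by gcongr; linarith)
  · refine ⟨⟨⌊(n : ℝ) * x⌋₊, ?_⟩, ?_, ?_⟩
    · have : ⌊(n : ℝ) * x⌋₊ ≤ n := Nat.floor_le_of_le (by nlinarith [x.2.2])
      omega
    · conv_rhs => rw [← hvx x]
      refine Set.monotone_projIcc _ ?_
      gcongr
      exact Nat.floor_le (mul_nonneg hn0.le x.2.1)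
    · conv_lhs => rw [← hvx x]
      refine Set.monotone_projIcc _ ?_
      gcongr
      exact (Nat.lt_floor_add_one _).le
  · set m : ℤ := ((k : ℕ) : ℤ) with hm
    have hmk : (m : ℝ) = ((k : ℕ) : ℝ) := by simp [hm]
    have hr : Continuous fun q : I × ℝ => (v (m + (q.2 - l m q.1) / Δ m q.1), q.1) := by
      have h1 := hlcont m
      have h2 := hΔcont m
      refine Continuous.prodMk (hvcont.comp (continuous_const.add (Continuous.div ?_ ?_ ?_)))
        continuous_fst
      · fun_prop
      · fun_prop
      · exact fun q => (hΔk m q.1).1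
    refine ⟨⟨_, hr⟩, ?_⟩
    rintro x ⟨hx1, hx2⟩ y
    have hkn : ((k : ℕ) : ℝ) ≤ n := by exact_mod_cast Nat.lt_succ_iff.1 k.2
    have h1 : (m : ℝ) ≤ n * x := by
      have h : ((v k : I) : ℝ) ≤ x := hx1
      simp only [hv, Set.coe_projIcc] at h
      rw [min_eq_right ((div_le_one hn0).2 hkn), max_eq_right (by positivity),
        div_le_iff₀ hn0] at h
      linarith
    have h2 : (n : ℝ) * x ≤ m + 1 := by
      have h : (x : ℝ) ≤ (v (k + 1) : I) := hx2
      simp only [hv, Set.coe_projIcc] at h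
      have h' := h.trans (max_le (by positivity) (min_le_right _ _))
      rw [le_div_iff₀ hn0] at h'
      linarith
    have h3 : F ⌊(n : ℝ) * x⌋ (x, y) = F m (x, y) := by
      rcases h2.lt_or_eq with h | h
      · rw [show ⌊(n : ℝ) * x⌋ = m from Int.floor_eq_iff.2 ⟨h1, h⟩]
      · rw [show ⌊(n : ℝ) * x⌋ = m + 1 from
          Int.floor_eq_iff.2 (by push_cast; constructor <;> linarith), hglue m (x, y) h]
    change (v (m + (F ⌊(n : ℝ) * x⌋ (x, y) - l m y) / Δ m y), y) = (x, y)
    rw [h3]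
    have h4 : (m : ℝ) + (F m (x, y) - l m y) / Δ m y = n * x := by
      simp only [hF]
      rw [add_sub_cancel_left, mul_div_cancel_right₀ _ (hΔk m y).1]
      ring
    rw [h4, hvx]

end Levels

section LevelDisjoint

variable {X : Type*} [MetricSpace X]

/-- Pairs of maps of the square whose restrictions to two given vertical strips have disjoint
images at equal levels of `α` and `β`. -/
def levelDisjointPairs (X : Type*) [MetricSpace X] (α β : C(I × I, ℝ)) (a b a' b' : I) :
    Set (C(I × I, X) × C(I × I, X)) :=
  {F | ∀ p q : I × I, p.1 ∈ Set.Icc a b → q.1 ∈ Set.Icc a' b' → α p = β q → F.1 p ≠ F.2 q}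

lemma isOpen_levelDisjointPairs (α β : C(I × I, ℝ)) (a b a' b' : I) :
    IsOpen (levelDisjointPairs X α β a b a' b') := by
  have hK : IsCompact {pq : (I × I) × (I × I) | pq.1.1 ∈ Set.Icc a b ∧ pq.2.1 ∈ Set.Icc a' b' ∧
      α pq.1 = β pq.2} := by
    refine IsClosed.isCompact ?_
    refine (isClosed_Icc.preimage (by fun_prop)).inter
      ((isClosed_Icc.preimage (by fun_prop)).inter (isClosed_eq (by fun_prop) (by fun_prop)))
  rw [isOpen_iff_eventually]
  intro F hF
  have := hK.eventually_forall_of_forall_eventually (x₀ := F)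
    (P := fun F pq => F.1 pq.1 ≠ F.2 pq.2) ?_
  · filter_upwards [this] with G hG p q hp hq hpq
    exact hG (p, q) ⟨hp, hq, hpq⟩
  · rintro ⟨p, q⟩ ⟨hp, hq, hpq⟩
    refine IsOpen.eventually_mem (isOpen_ne_fun ?_ ?_) (hF p q hp hq hpq) <;> fun_prop

lemma dense_levelDisjointPairs (hlc : LocallyContractible X)
    (hdhp : DisjointHomotopiesProperty X) (α β : C(I × I, ℝ)) {a b a' b' : I} (hab : a ≤ b)
    (hab' : a' ≤ b') (r r' : C(I × ℝ, I × I))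
    (hr : ∀ x ∈ Set.Icc a b, ∀ y, r (y, α (x, y)) = (x, y))
    (hr' : ∀ x ∈ Set.Icc a' b', ∀ y, r' (y, β (x, y)) = (x, y)) :
    Dense (levelDisjointPairs X α β a b a' b') := by
  rw [Metric.dense_iff]
  rintro ⟨f, g⟩ ε hε
  obtain ⟨δ₁, hδ₁, hf⟩ := hlc.exists_extension_strip f hab hε
  obtain ⟨δ₂, hδ₂, hg⟩ := hlc.exists_extension_strip g hab' hε
  obtain ⟨C, hC, hαC, hβC⟩ : ∃ C > 0, (∀ p, |α p| ≤ C) ∧ ∀ p, |β p| ≤ C := by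
    refine ⟨‖α‖ + ‖β‖ + 1, by positivity, fun p => ?_, fun p => ?_⟩
    · linarith [α.norm_coe_le_norm p, norm_nonneg β, Real.norm_eq_abs (α p)]
    · linarith [β.norm_coe_le_norm p, norm_nonneg α, Real.norm_eq_abs (β p)]
  let τ : C(ℝ, I) := ⟨fun t => Set.projIcc 0 1 zero_le_one ((t + C) / (2 * C)),
    continuous_projIcc.comp (by fun_prop)⟩
  let scale : C(I × I, I × ℝ) := ⟨fun p => (p.1, 2 * C * p.2 - C), by fun_prop⟩
  have hscale : ∀ t, |t| ≤ C → ∀ y, scale (y, τ t) = (y, t) := by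
    intro t ht y
    obtain ⟨h1, h2⟩ := abs_le.1 ht
    have h3 : (t + C) / (2 * C) ∈ Set.Icc (0 : ℝ) 1 :=
      ⟨div_nonneg (by linarith) (by linarith), (div_le_one (by linarith)).2 (by linarith)⟩
    refine Prod.ext rfl ?_
    change 2 * C * ((Set.projIcc 0 1 zero_le_one ((t + C) / (2 * C)) : I) : ℝ) - C = t
    rw [Set.projIcc_of_mem _ h3]
    field_simp
    ring
  obtain ⟨Φ, Γ, hΦ, hΓ, hdisj⟩ := hdhp (f.comp (r.comp scale)) (g.comp (r'.comp scale))
    (min δ₁ δ₂) (lt_min hδ₁ hδ₂)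
  obtain ⟨f', hf'0, hf'⟩ := hf (Φ.comp ⟨fun p => (p.2, τ (α p)), by fun_prop⟩) (by
    intro x hx y
    have := hΦ (y, τ (α (x, y)))
    rw [dist_comm]
    simp only [ContinuousMap.comp_apply, hscale _ (hαC _), hr x hx] at this
    exact this.trans_le (min_le_left _ _))
  obtain ⟨g', hg'0, hg'⟩ := hg (Γ.comp ⟨fun p => (p.2, τ (β p)), by fun_prop⟩) (by
    intro x hx y
    have := hΓ (y, τ (β (x, y)))
    rw [dist_comm]
    simp only [ContinuousMap.comp_apply, hscale _ (hβC _), hr' x hx] at this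
    exact this.trans_le (min_le_right _ _))
  refine ⟨(f', g'), ?_, ?_⟩
  · rw [Metric.mem_ball, Prod.dist_eq, max_lt_iff]
    exact ⟨(ContinuousMap.dist_lt_iff hε).2 hf', (ContinuousMap.dist_lt_iff hε).2 hg'⟩
  · rintro ⟨x, y⟩ ⟨x', y'⟩ hp hq hpq
    change f' (x, y) ≠ g' (x', y')
    rw [hf'0 x hp, hg'0 x' hq]
    change Φ (y, τ (α (x, y))) ≠ Γ (y', τ (β (x', y')))
    rw [hpq]
    exact hdisj _ _ _

/-- The disjoint disks property of `X × ℝ`, for maps of the square. -/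
lemma exists_disjoint_squares (hlc : LocallyContractible X)
    (hdhp : DisjointHomotopiesProperty X) (F G : C(I × I, X × ℝ)) {ε : ℝ} (hε : 0 < ε) :
    ∃ F' G' : C(I × I, X × ℝ), (∀ p, dist (F p) (F' p) < ε) ∧ (∀ p, dist (G p) (G' p) < ε) ∧
      ∀ p q, F' p ≠ G' q := by
  obtain ⟨α, hα, m, a, b, hab, hcov, hr⟩ :=
    exists_strip_coordinates (ContinuousMap.snd.comp F) hε
  obtain ⟨β, hβ, n, a', b', hab', hcov', hr'⟩ :=
    exists_strip_coordinates (ContinuousMap.snd.comp G) hε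
  choose r hr using hr
  choose r' hr' using hr'
  have hdense : Dense (⋂₀ Set.range fun k : Fin m × Fin n =>
      levelDisjointPairs X α β (a k.1) (b k.1) (a' k.2) (b' k.2)) := by
    refine (Set.finite_range _).dense_sInter ?_ ?_ <;> rintro _ ⟨k, rfl⟩
    · exact isOpen_levelDisjointPairs _ _ _ _ _ _
    · exact dense_levelDisjointPairs hlc hdhp α β (hab _) (hab' _) (r k.1) (r' k.2) (hr _) (hr' _)
  obtain ⟨⟨f, g⟩, hfg, hmem⟩ := Metric.dense_iff.1 hdense
    (ContinuousMap.fst.comp F, ContinuousMap.fst.comp G) ε hε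
  rw [Metric.mem_ball', Prod.dist_eq, max_lt_iff] at hfg
  refine ⟨f.prodMk α, g.prodMk β, fun p => ?_, fun p => ?_, fun p q hpq => ?_⟩
  · exact max_lt ((ContinuousMap.dist_lt_iff hε).1 hfg.1 p) (hα p)
  · exact max_lt ((ContinuousMap.dist_lt_iff hε).1 hfg.2 p) (hβ p)
  · obtain ⟨i, hi⟩ := hcov p.1
    obtain ⟨j, hj⟩ := hcov' q.1
    obtain ⟨h1, h2⟩ := Prod.ext_iff.1 hpq
    exact hmem _ ⟨(i, j), rfl⟩ p q hi hj h2 h1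

end LevelDisjoint

/-- The disk is a retract of the square. -/
lemma exists_disk_retract_of_square :
    ∃ (e : C(D2, I × I)) (R : C(I × I, D2)), ∀ p, R (e p) = p := by
  let w : I × I → EuclideanSpace ℝ (Fin 2) := fun p => !₂[2 * (p.1 : ℝ) - 1, 2 * (p.2 : ℝ) - 1]
  have hw : Continuous w := by
    refine (PiLp.continuous_toLp 2 _).comp (continuous_pi fun i => ?_)
    fin_cases i <;> simp <;> fun_prop
  have hcoord : ∀ (p : D2) (i : Fin 2), |p.1 i| ≤ 1 := fun p i =>
    (PiLp.norm_apply_le p.1 i).trans (mem_closedBall_zero_iff.1 p.2)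
  have hmem : ∀ (p : D2) (i : Fin 2), (p.1 i + 1) / 2 ∈ Set.Icc (0 : ℝ) 1 := fun p i => by
    have := abs_le.1 (hcoord p i)
    constructor <;> linarith
  refine ⟨⟨fun p => (⟨(p.1 0 + 1) / 2, hmem p 0⟩, ⟨(p.1 1 + 1) / 2, hmem p 1⟩), by fun_prop⟩,
    ⟨fun p => ⟨(max 1 ‖w p‖)⁻¹ • w p, ?_⟩, ?_⟩, fun p => ?_⟩
  · rw [D2, mem_closedBall_zero_iff, norm_smul, norm_inv, Real.norm_of_nonneg (by positivity),
      inv_mul_le_one₀ (by positivity)]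
    exact le_max_right _ _
  · have hmax : Continuous fun p => max 1 ‖w p‖ := continuous_const.max hw.norm
    exact ((hmax.inv₀ fun p => by positivity).smul hw).subtype_mk _
  · have h : w (⟨(p.1 0 + 1) / 2, hmem p 0⟩, ⟨(p.1 1 + 1) / 2, hmem p 1⟩) = p.1 := by
      ext i
      fin_cases i <;> simp [w] <;> ring
    refine Subtype.ext ?_
    simp only [ContinuousMap.coe_mk, h]
    rw [max_eq_left (mem_closedBall_zero_iff.1 p.2), inv_one, one_smul]

/-- if a locally compact, locally contractible metric space (e.g. a
locally compact metric ANR) `X` has the disjoint homotopies property, then `X × ℝ`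
has the disjoint disks property. -/
theorem dhp_implies_ddp_of_product_with_line
    {X : Type*} [MetricSpace X] [LocallyCompactSpace X]
    (hlc : LocallyContractible X)
    (hdhp : DisjointHomotopiesProperty X) :
    DisjointDisksProperty (X × ℝ) := by
  intro f g ε hε
  obtain ⟨e, R, hR⟩ := exists_disk_retract_of_square
  obtain ⟨F, G, hF, hG, hFG⟩ := exists_disjoint_squares hlc hdhp (f.comp R) (g.comp R) hε
  refine ⟨F.comp e, G.comp e, fun p => ?_, fun p => ?_, ?_⟩
  · simpa [hR] using hF (e p)
  · simpa [hR] using hG (e p)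
  · refine Set.disjoint_iff_inter_eq_empty.1 (Set.disjoint_left.2 ?_)
    rintro _ ⟨p, rfl⟩ ⟨q, hq⟩
    exact hFG _ _ hq.symm
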